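/- arXiv:0811.1012 — 7 statements merged into one kernel-verified Lean document; each statement's English description precedes it below -/
import Mathlib

section
/- Let f : ℝ³ → ℝ, written f(x; y, z), be continuously differentiable and satisfy the input symmetry f(x; y, z) = f(x; z, y) for all x, y, z ∈ ℝ, and let θ = (θ₁,θ₂,θ₃,θ₄) : ℝ → ℝ⁴ be a differentiable solution of the four-cell system θ₁' = ω + f(θ₁;θ₂,θ₃), θ₂' = ω + f(θ₂;θ₁,θ₄), θ₃' = ω + f(θ₃;θ₁,θ₂), θ₄' = ω + f(θ₄;θ₁,θ₂). If θ₁(0) = θ₃(0) and θ₂(0) = θ₄(0), then θ₁(t) = θ₃(t) and θ₂(t) = θ₄(t) for all t ∈ ℝ (the subspace V₂ = {θ₁ = θ₃, θ₂ = θ₄} is flow-invariant). -/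
/-- Two cells that read a common input `p` and each other stay synchronised: both solve the scalar
equation `x' = ω + f (x, p t, g t + h t - x)`. -/
theorem pair_sync (f : ℝ × ℝ × ℝ → ℝ) (hf : ContDiff ℝ 1 f) (ω : ℝ)
    (g h p : ℝ → ℝ) (hp : Continuous p)
    (hg : ∀ t : ℝ, HasDerivAt g (ω + f (g t, p t, h t)) t)
    (hh : ∀ t : ℝ, HasDerivAt h (ω + f (h t, p t, g t)) t)
    (h0 : g 0 = h 0) (t : ℝ) : g t = h t := by
  have cg : Continuous g := continuous_iff_continuousAt.2 fun t => (hg t).continuousAt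
  have ch : Continuous h := continuous_iff_continuousAt.2 fun t => (hh t).continuousAt
  set T : ℝ := |t| + 1 with hT
  obtain ⟨R, hR⟩ := (isCompact_Icc (a := -T) (b := T)).exists_bound_of_continuousOn
    (f := fun t => (g t, p t, h t)) (by fun_prop)
  have hB : ∀ s ∈ Set.Ioo (-T) T, |g s| ≤ R ∧ |p s| ≤ R ∧ |h s| ≤ R := by
    intro s hs
    have := hR s (Set.Ioo_subset_Icc_self hs)
    simpa [Prod.norm_def, Real.norm_eq_abs] using this
  obtain ⟨C, hC⟩ := (isCompact_closedBall (0 : ℝ × ℝ × ℝ) (3 * R)).exists_bound_of_continuousOn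
    (f := fderiv ℝ f) (hf.continuous_fderiv (by norm_num)).continuousOn
  have hL : LipschitzOnWith C.toNNReal f (Metric.closedBall (0 : ℝ × ℝ × ℝ) (3 * R)) := by
    apply (convex_closedBall _ _).lipschitzOnWith_of_nnnorm_fderiv_le (𝕜 := ℝ)
    · intro x _
      exact (hf.differentiable (by norm_num)) x
    · intro x hx
      exact NNReal.le_toNNReal_of_coe_le (hC x hx)
  have h0T : (0 : ℝ) ∈ Set.Ioo (-T) T := by
    constructor <;> linarith [abs_nonneg t]
  have htT : t ∈ Set.Ioo (-T) T := by
    constructor <;> linarith [neg_abs_le t, le_abs_self t]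
  refine ODE_solution_unique_of_mem_Ioo (K := C.toNNReal)
    (v := fun s x => ω + f (x, p s, g s + h s - x)) (s := fun _ => {x | |x| ≤ R})
    ?_ h0T ?_ ?_ h0 htT
  · intro s hs
    obtain ⟨b1, b2, b3⟩ := hB s hs
    have mem : ∀ x : ℝ, |x| ≤ R →
        (x, p s, g s + h s - x) ∈ Metric.closedBall (0 : ℝ × ℝ × ℝ) (3 * R) := by
      intro x hx
      rw [mem_closedBall_zero_iff]
      simp only [Prod.norm_def, Real.norm_eq_abs, max_le_iff]
      simp only [abs_le] at *
      refine ⟨⟨?_, ?_⟩, ⟨?_, ?_⟩, ⟨?_, ?_⟩⟩ <;> linarith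
    apply LipschitzOnWith.of_dist_le_mul
    intro x hx y hy
    have := hL.dist_le_mul _ (mem x hx) _ (mem y hy)
    have e : dist (x, p s, g s + h s - x) (y, p s, g s + h s - y) = dist x y := by
      simp only [Prod.dist_eq, dist_self, dist_sub_left]
      simp
    rw [e] at this
    simpa only [dist_add_left] using this
  · intro s hs
    refine ⟨?_, (hB s hs).1⟩
    have := hg s
    simpa using this
  · intro s hs
    refine ⟨?_, (hB s hs).2.2⟩
    have := hh s
    simpa using this

/-- For the four-cell coupled oscillator system with C¹ coupling f
satisfying the input symmetry, the subspace V₂ = {θ₁ = θ₃, θ₂ = θ₄} is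
flow-invariant. -/
theorem V2_invariant (f : ℝ × ℝ × ℝ → ℝ) (hf : ContDiff ℝ 1 f)
    (hsym : ∀ x y z : ℝ, f (x, y, z) = f (x, z, y)) (ω : ℝ)
    (θ1 θ2 θ3 θ4 : ℝ → ℝ)
    (h1 : ∀ t : ℝ, HasDerivAt θ1 (ω + f (θ1 t, θ2 t, θ3 t)) t)
    (h2 : ∀ t : ℝ, HasDerivAt θ2 (ω + f (θ2 t, θ1 t, θ4 t)) t)
    (h3 : ∀ t : ℝ, HasDerivAt θ3 (ω + f (θ3 t, θ1 t, θ2 t)) t)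
    (h4 : ∀ t : ℝ, HasDerivAt θ4 (ω + f (θ4 t, θ1 t, θ2 t)) t)
    (h0 : θ1 0 = θ3 0) (h0' : θ2 0 = θ4 0) :
    ∀ t : ℝ, θ1 t = θ3 t ∧ θ2 t = θ4 t := by
  have c1 : Continuous θ1 := continuous_iff_continuousAt.2 fun t => (h1 t).continuousAt
  have c2 : Continuous θ2 := continuous_iff_continuousAt.2 fun t => (h2 t).continuousAt
  intro t
  refine ⟨pair_sync f hf ω θ1 θ3 θ2 c2 h1 (fun s => ?_) h0 t,
    pair_sync f hf ω θ2 θ4 θ1 c1 h2 h4 h0' t⟩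
  rw [hsym]
  exact h3 s
end

section
/- Let f : ℝ³ → ℝ, written f(x; y, z), satisfy the phase-shift symmetry f(x+ε; y+ε, z+ε) = f(x; y, z) for all x, y, z, ε ∈ ℝ, and let θ = (θ₁,θ₂,θ₃,θ₄) : ℝ → ℝ⁴ be a differentiable solution of the four-cell system θ₁' = ω + f(θ₁;θ₂,θ₃), θ₂' = ω + f(θ₂;θ₁,θ₄), θ₃' = ω + f(θ₃;θ₁,θ₂), θ₄' = ω + f(θ₄;θ₁,θ₂). Define φ₁ = θ₁−θ₃, φ₂ = θ₂−θ₄, φ₃ = θ₃−θ₄. Then (φ₁,φ₂,φ₃) satisfies the reduced phase-difference system: φ₁' = f(φ₁; φ₂−φ₃, 0) − f(0; φ₁, φ₂−φ₃), φ₂' = f(φ₂; φ₁+φ₃, 0) − f(0; φ₁+φ₃, φ₂), φ₃' = f(φ₃; φ₁+φ₃, φ₂) − f(0; φ₁+φ₃, φ₂). -/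
/-- Under the phase-shift symmetry, the phase differences
φ₁ = θ₁−θ₃, φ₂ = θ₂−θ₄, φ₃ = θ₃−θ₄ of a solution of the four-cell system satisfy
the reduced phase-difference equations. -/
theorem phase_difference_reduction (f : ℝ × ℝ × ℝ → ℝ) (ω : ℝ)
    (hshift : ∀ x y z ε : ℝ, f (x + ε, y + ε, z + ε) = f (x, y, z))
    (θ1 θ2 θ3 θ4 : ℝ → ℝ)
    (h1 : ∀ t : ℝ, HasDerivAt θ1 (ω + f (θ1 t, θ2 t, θ3 t)) t)
    (h2 : ∀ t : ℝ, HasDerivAt θ2 (ω + f (θ2 t, θ1 t, θ4 t)) t)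
    (h3 : ∀ t : ℝ, HasDerivAt θ3 (ω + f (θ3 t, θ1 t, θ2 t)) t)
    (h4 : ∀ t : ℝ, HasDerivAt θ4 (ω + f (θ4 t, θ1 t, θ2 t)) t) :
    ∀ t : ℝ,
      HasDerivAt (fun s => θ1 s - θ3 s)
        (f (θ1 t - θ3 t, (θ2 t - θ4 t) - (θ3 t - θ4 t), 0)
          - f (0, θ1 t - θ3 t, (θ2 t - θ4 t) - (θ3 t - θ4 t))) t ∧
      HasDerivAt (fun s => θ2 s - θ4 s)
        (f (θ2 t - θ4 t, (θ1 t - θ3 t) + (θ3 t - θ4 t), 0)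
          - f (0, (θ1 t - θ3 t) + (θ3 t - θ4 t), θ2 t - θ4 t)) t ∧
      HasDerivAt (fun s => θ3 s - θ4 s)
        (f (θ3 t - θ4 t, (θ1 t - θ3 t) + (θ3 t - θ4 t), θ2 t - θ4 t)
          - f (0, (θ1 t - θ3 t) + (θ3 t - θ4 t), θ2 t - θ4 t)) t := by
  have key : ∀ x y z c a b d : ℝ, a + c = x → b + c = y → d + c = z →
      f (x, y, z) = f (a, b, d) := by
    intro x y z c a b d hx hy hz
    rw [← hx, ← hy, ← hz]
    exact hshift a b d c
  intro t
  refine ⟨?_, ?_, ?_⟩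
  · refine ((h1 t).sub (h3 t)).congr_deriv ?_
    rw [key (θ1 t) (θ2 t) (θ3 t) (θ3 t) (θ1 t - θ3 t) ((θ2 t - θ4 t) - (θ3 t - θ4 t)) 0
        (by ring) (by ring) (by ring),
      key (θ3 t) (θ1 t) (θ2 t) (θ3 t) 0 (θ1 t - θ3 t) ((θ2 t - θ4 t) - (θ3 t - θ4 t))
        (by ring) (by ring) (by ring)]
    ring
  · refine ((h2 t).sub (h4 t)).congr_deriv ?_
    rw [key (θ2 t) (θ1 t) (θ4 t) (θ4 t) (θ2 t - θ4 t) ((θ1 t - θ3 t) + (θ3 t - θ4 t)) 0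
        (by ring) (by ring) (by ring),
      key (θ4 t) (θ1 t) (θ2 t) (θ4 t) 0 ((θ1 t - θ3 t) + (θ3 t - θ4 t)) (θ2 t - θ4 t)
        (by ring) (by ring) (by ring)]
    ring
  · refine ((h3 t).sub (h4 t)).congr_deriv ?_
    rw [key (θ3 t) (θ1 t) (θ2 t) (θ4 t) (θ3 t - θ4 t) ((θ1 t - θ3 t) + (θ3 t - θ4 t))
        (θ2 t - θ4 t) (by ring) (by ring) (by ring),
      key (θ4 t) (θ1 t) (θ2 t) (θ4 t) 0 ((θ1 t - θ3 t) + (θ3 t - θ4 t)) (θ2 t - θ4 t)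
        (by ring) (by ring) (by ring)]
    ring
end

section
/- Let f : ℝ³ → ℝ, written f(x; y, z), satisfy the input symmetry f(x; y, z) = f(x; z, y) and the phase-shift symmetry f(x+ε; y+ε, z+ε) = f(x; y, z) for all x, y, z, ε ∈ ℝ. Define the reduced vector field G : ℝ³ → ℝ³ by G(φ₁,φ₂,φ₃) = (f(φ₁; φ₂−φ₃, 0) − f(0; φ₁, φ₂−φ₃), f(φ₂; φ₁+φ₃, 0) − f(0; φ₁+φ₃, φ₂), f(φ₃; φ₁+φ₃, φ₂) − f(0; φ₁+φ₃, φ₂)), and let ρ : ℝ³ → ℝ³ be ρ(φ₁,φ₂,φ₃) = (φ₂, φ₁, −φ₃). Then G is ρ-equivariant: G(ρφ) = ρ(G(φ)) for all φ ∈ ℝ³. -/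
/-- The reduced phase-difference vector field G on ℝ³. -/
noncomputable def reducedField (f : ℝ × ℝ × ℝ → ℝ) : ℝ × ℝ × ℝ → ℝ × ℝ × ℝ :=
  fun φ => (f (φ.1, φ.2.1 - φ.2.2, 0) - f (0, φ.1, φ.2.1 - φ.2.2),
            f (φ.2.1, φ.1 + φ.2.2, 0) - f (0, φ.1 + φ.2.2, φ.2.1),
            f (φ.2.2, φ.1 + φ.2.2, φ.2.1) - f (0, φ.1 + φ.2.2, φ.2.1))

/-- The symmetry ρ(φ₁,φ₂,φ₃) = (φ₂,φ₁,−φ₃). -/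
def rhoPerm : ℝ × ℝ × ℝ → ℝ × ℝ × ℝ := fun φ => (φ.2.1, φ.1, -φ.2.2)

/-- The reduced phase-difference vector field G is equivariant
under ρ(φ₁,φ₂,φ₃) = (φ₂,φ₁,−φ₃). -/
theorem reducedField_rho_equivariant (f : ℝ × ℝ × ℝ → ℝ)
    (hsym : ∀ x y z : ℝ, f (x, y, z) = f (x, z, y))
    (hshift : ∀ x y z ε : ℝ, f (x + ε, y + ε, z + ε) = f (x, y, z)) :
    ∀ φ : ℝ × ℝ × ℝ, reducedField f (rhoPerm φ) = rhoPerm (reducedField f φ) := by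
  rintro ⟨a, b, c⟩
  have h1 := hshift (-c) (b - c) a c
  have h2 := hshift 0 (b - c) a c
  rw [neg_add_cancel, sub_add_cancel, hsym] at h1
  rw [zero_add, sub_add_cancel, hsym] at h2
  simp only [reducedField, rhoPerm, sub_neg_eq_add, ← sub_eq_add_neg, Prod.mk.injEq]
  refine ⟨?_, ?_, ?_⟩
  · rw [hsym 0 b]
  · rw [hsym 0 a]
  · rw [← h1, ← h2, neg_sub]
end

section
/- Let f : ℝ³ → ℝ, written f(x; y, z), be twice continuously differentiable, satisfy the input symmetry f(x; y, z) = f(x; z, y), and satisfy the phase-shift symmetry f(x+ε; y+ε, z+ε) = f(x; y, z) for all x, y, z, ε ∈ ℝ. Define F : ℝ → ℝ by F(u) = f(0; 0, −u) − f(0; u, 0). Then F(0) = 0, F′(0) = ∂₁f(0,0,0), and F″(0) = 0. -/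
/-- For C² f with input and phase-shift symmetry, the reduced map
F(u) = f(0;0,−u) − f(0;u,0) satisfies F(0) = 0, F′(0) = ∂₁f(0,0,0), F″(0) = 0. -/
theorem pitchfork_reduced_derivatives (f : ℝ × ℝ × ℝ → ℝ)
    (hf : ContDiff ℝ 2 f)
    (hsym : ∀ x y z : ℝ, f (x, y, z) = f (x, z, y))
    (hshift : ∀ x y z ε : ℝ, f (x + ε, y + ε, z + ε) = f (x, y, z))
    (F : ℝ → ℝ) (hF : ∀ u : ℝ, F u = f (0, 0, -u) - f (0, u, 0)) :
    F 0 = 0 ∧ deriv F 0 = fderiv ℝ f (0, 0, 0) (1, 0, 0) ∧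
      iteratedDeriv 2 F 0 = 0 := by
  have hd : HasFDerivAt f (fderiv ℝ f (0, 0, 0)) (0, 0, 0) :=
    (hf.differentiable (by norm_num) _).hasFDerivAt
  have key : ∀ a b c : ℝ, HasDerivAt (fun t : ℝ => f (t * a, t * b, t * c))
      (fderiv ℝ f (0, 0, 0) (a, b, c)) 0 := by
    intro a b c
    have h1 : ∀ r : ℝ, HasDerivAt (fun t : ℝ => t * r) r 0 := fun r => by
      simpa using (hasDerivAt_id (0 : ℝ)).mul_const r
    have h2 : HasDerivAt (fun t : ℝ => (t * a, t * b, t * c)) (a, b, c) 0 :=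
      (h1 a).prodMk ((h1 b).prodMk (h1 c))
    exact HasFDerivAt.comp_hasDerivAt (0 : ℝ) (by simpa using hd) h2
  refine ⟨?_, ?_, ?_⟩
  · rw [hF]; simp
  · have hA : fderiv ℝ f (0, 0, 0) (1, 1, 1) = 0 := by
      refine (key 1 1 1).unique ?_
      have : (fun t : ℝ => f (t * 1, t * 1, t * 1)) = fun _ => f (0, 0, 0) := by
        funext t
        simpa using hshift 0 0 0 t
      rw [this]
      exact hasDerivAt_const _ _
    have hB : fderiv ℝ f (0, 0, 0) (0, 1, 0) = fderiv ℝ f (0, 0, 0) (0, 0, 1) := by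
      refine (key 0 1 0).unique ?_
      have : (fun t : ℝ => f (t * 0, t * 1, t * 0)) = fun t => f (t * 0, t * 0, t * 1) := by
        funext t
        exact hsym _ _ _
      rw [this]
      exact key 0 0 1
    have hD : fderiv ℝ f (0, 0, 0) (0, 0, -1) = - fderiv ℝ f (0, 0, 0) (0, 0, 1) := by
      rw [← map_neg]; simp
    have hS : fderiv ℝ f (0, 0, 0) (1, 1, 1) = fderiv ℝ f (0, 0, 0) (1, 0, 0)
        + fderiv ℝ f (0, 0, 0) (0, 1, 0) + fderiv ℝ f (0, 0, 0) (0, 0, 1) := by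
      rw [← map_add, ← map_add]; simp
    have hFe : F = fun t : ℝ => f (t * 0, t * 0, t * (-1)) - f (t * 0, t * 1, t * 0) := by
      funext t
      simpa using hF t
    have h := ((key 0 0 (-1)).sub (key 0 1 0)).deriv
    rw [hFe]
    refine h.trans ?_
    linarith
  · have hodd : (fun u => F (-u)) = fun u => -F u := by
      funext u
      simp only [hF, neg_neg]
      rw [hsym 0 0 u, hsym 0 0 (-u)]
      ring
    have h1 := iteratedDeriv_comp_neg 2 F 0
    have h2 : iteratedDeriv 2 (fun u => -F u) 0 = - iteratedDeriv 2 F 0 :=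
      iteratedDeriv_fun_neg 2 F 0
    rw [hodd, h2] at h1
    simp at h1
    linarith
end

section
/- Let g : ℝ → ℝ be g(x) = −sin(x+α₁) + r₂·sin(2x+α₂) with r₂·cos α₂ ≠ 0, and let H : ℝ³ → ℝ³ be the reduced vector field H(φ₁,φ₂,φ₃) = (g(φ₁+φ₃−φ₂)+g(φ₁)−g(−φ₁)−g(φ₃−φ₂), g(φ₂−φ₃−φ₁)+g(φ₂)−g(−φ₃−φ₁)−g(−φ₂), g(−φ₁)+g(φ₃−φ₂)−g(−φ₃−φ₁)−g(−φ₂)). If p₃ ∈ ℝ satisfies cos p₃ = cos α₁ / (2 r₂ cos α₂), then (0, 0, p₃) is an equilibrium of H, i.e., H(0,0,p₃) = (0,0,0). -/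
/-- The two-harmonic coupling function g(x) = −sin(x+α₁) + r₂ sin(2x+α₂). -/
noncomputable def coupling (α₁ α₂ r₂ : ℝ) : ℝ → ℝ :=
  fun x => -Real.sin (x + α₁) + r₂ * Real.sin (2 * x + α₂)

/-- The reduced phase-difference vector field for f(x;y,z) = g(x−y)+g(x−z). -/
noncomputable def reducedFieldG (g : ℝ → ℝ) : ℝ × ℝ × ℝ → ℝ × ℝ × ℝ :=
  fun φ => (g (φ.1 + φ.2.2 - φ.2.1) + g φ.1 - g (-φ.1) - g (φ.2.2 - φ.2.1),
            g (φ.2.1 - φ.2.2 - φ.1) + g φ.2.1 - g (-φ.2.2 - φ.1) - g (-φ.2.1),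
            g (-φ.1) + g (φ.2.2 - φ.2.1) - g (-φ.2.2 - φ.1) - g (-φ.2.1))

/-- If cos p₃ = cos α₁ / (2 r₂ cos α₂) (with r₂ cos α₂ ≠ 0), then
(0,0,p₃) is an equilibrium of the reduced phase-difference vector field. -/
theorem equilibrium_on_V2_two_harmonics (α₁ α₂ r₂ p₃ : ℝ)
    (hb : r₂ * Real.cos α₂ ≠ 0)
    (hp : Real.cos p₃ = Real.cos α₁ / (2 * r₂ * Real.cos α₂)) :
    reducedFieldG (coupling α₁ α₂ r₂) (0, 0, p₃) = (0, 0, 0) := by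
  have h : Real.cos p₃ * (2 * r₂ * Real.cos α₂) = Real.cos α₁ := by
    rw [hp]
    apply div_mul_cancel₀
    intro h0
    apply hb
    linarith
  have key : coupling α₁ α₂ r₂ p₃ = coupling α₁ α₂ r₂ (-p₃) := by
    unfold coupling
    have e : 2 * -p₃ = -(2 * p₃) := by ring
    simp only [e, Real.sin_add, Real.sin_neg, Real.cos_neg, Real.sin_two_mul]
    linear_combination (2 * Real.sin p₃) * h
  simp [reducedFieldG, key]
end

section
/- (Appendix, case r₂ cos α₂ < 0.) Let g : ℝ → ℝ be g(x) = −sin(x+α₁) + r₂·sin(2x+α₂), so that g′(x) = −cos(x+α₁) + 2r₂·cos(2x+α₂). Set b = r₂·cos α₂ and suppose b < 0, cos²α₁ ≤ 4b², and p ∈ ℝ satisfies cos p = cos α₁ / (2b) (the existence condition for the equilibrium). Then the radial eigenvalue is nonnegative: λ₃ = g′(p) + g′(−p) ≥ 0. Consequently, the necessary condition λ₃ < 0 for an asymptotically stable heteroclinic network through this equilibrium fails. -/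
/-- Appendix, case r₂ cos α₂ < 0: with b = r₂ cos α₂ < 0,
cos²α₁ ≤ 4b² and cos p = cos α₁/(2b), the radial eigenvalue
λ₃ = g′(p) + g′(−p) is nonnegative, so the necessary stability condition
λ₃ < 0 fails. -/
theorem radial_eigenvalue_nonneg (α₁ α₂ r₂ p : ℝ)
    (hb : r₂ * Real.cos α₂ < 0)
    (hex : Real.cos α₁ ^ 2 ≤ 4 * (r₂ * Real.cos α₂) ^ 2)
    (hp : Real.cos p = Real.cos α₁ / (2 * (r₂ * Real.cos α₂))) :
    0 ≤ deriv (coupling α₁ α₂ r₂) p + deriv (coupling α₁ α₂ r₂) (-p) ∧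
      ¬(deriv (coupling α₁ α₂ r₂) p + deriv (coupling α₁ α₂ r₂) (-p) < 0) := by
  have hd : ∀ x, deriv (coupling α₁ α₂ r₂) x
      = -Real.cos (x + α₁) + r₂ * (Real.cos (2 * x + α₂) * 2) := by
    intro x
    have h1 : HasDerivAt (fun x : ℝ => x + α₁) 1 x := (hasDerivAt_id x).add_const α₁
    have h2 : HasDerivAt (fun x : ℝ => 2 * x + α₂) (2 * 1) x :=
      ((hasDerivAt_id x).const_mul 2).add_const α₂
    have h3 := (h1.sin.neg).add (h2.sin.const_mul r₂)
    have h4 : HasDerivAt (coupling α₁ α₂ r₂) _ x := h3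
    rw [h4.deriv]
    ring
  have hc : Real.cos α₁ = 2 * (r₂ * Real.cos α₂) * Real.cos p := by
    have hne : 2 * (r₂ * Real.cos α₂) ≠ 0 := by
      intro h
      linarith
    rw [hp]
    exact (mul_div_cancel₀ _ hne).symm
  have key : deriv (coupling α₁ α₂ r₂) p + deriv (coupling α₁ α₂ r₂) (-p)
      = 4 * (r₂ * Real.cos α₂) * (Real.cos p ^ 2 - 1) := by
    have e : 2 * -p = -(2 * p) := by ring
    rw [hd, hd, e]
    simp only [Real.cos_add, Real.cos_neg, Real.sin_neg, Real.cos_two_mul]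
    rw [hc]
    ring
  have h0 : 0 ≤ deriv (coupling α₁ α₂ r₂) p + deriv (coupling α₁ α₂ r₂) (-p) := by
    rw [key]
    apply mul_nonneg_of_nonpos_of_nonpos
    · linarith
    · linarith [Real.cos_sq_le_one p]
  exact ⟨h0, not_lt.mpr h0⟩
end

section
/- (Appendix, case r₂ cos α₂ > 0.) Let g : ℝ → ℝ be g(x) = −sin(x+α₁) + r₂·sin(2x+α₂), so that g′(x) = −cos(x+α₁) + 2r₂·cos(2x+α₂). Set b = r₂·cos α₂ and suppose b > 0 and p ∈ ℝ satisfies cos p = cos α₁ / (2b). Then the sum of the expanding and contracting eigenvalues satisfies the identity λ₁ + λ₂ = g′(p) + g′(−p) + 4g′(0) = (cos α₁/√b − 2√b)², and hence λ₁ + λ₂ ≥ 0. Consequently, the asymptotic stability condition λ₁ + λ₂ < 0 for the heteroclinic network through this equilibrium fails; together with the opposite case this shows the heteroclinic ratchet cannot be asymptotically stable when the coupling function has only two harmonics. -/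
theorem coupling_deriv (α₁ α₂ r₂ x : ℝ) :
    deriv (coupling α₁ α₂ r₂) x = -Real.cos (x + α₁) + 2 * r₂ * Real.cos (2 * x + α₂) := by
  have h1 : HasDerivAt (fun x : ℝ => x + α₁) 1 x := (hasDerivAt_id x).add_const α₁
  have h2 : HasDerivAt (fun x : ℝ => 2 * x + α₂) (2 * 1) x :=
    ((hasDerivAt_id x).const_mul 2).add_const α₂
  have h : HasDerivAt (coupling α₁ α₂ r₂)
      (-(Real.cos (x + α₁) * 1) + r₂ * (Real.cos (2 * x + α₂) * (2 * 1))) x :=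
    h1.sin.neg.add (h2.sin.const_mul r₂)
  rw [h.deriv]
  ring

/-- Appendix, case r₂ cos α₂ > 0: with b = r₂ cos α₂ > 0 and
cos p = cos α₁/(2b), the sum of the expanding and contracting eigenvalues
satisfies λ₁ + λ₂ = g′(p) + g′(−p) + 4g′(0) = (cos α₁/√b − 2√b)² ≥ 0, so the
asymptotic stability condition λ₁ + λ₂ < 0 fails. -/
theorem eigenvalue_sum_nonneg (α₁ α₂ r₂ p : ℝ)
    (hb : 0 < r₂ * Real.cos α₂)
    (hp : Real.cos p = Real.cos α₁ / (2 * (r₂ * Real.cos α₂))) :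
    (deriv (coupling α₁ α₂ r₂) p + deriv (coupling α₁ α₂ r₂) (-p)
        + 4 * deriv (coupling α₁ α₂ r₂) 0 =
      (Real.cos α₁ / Real.sqrt (r₂ * Real.cos α₂)
        - 2 * Real.sqrt (r₂ * Real.cos α₂)) ^ 2) ∧
    0 ≤ deriv (coupling α₁ α₂ r₂) p + deriv (coupling α₁ α₂ r₂) (-p)
        + 4 * deriv (coupling α₁ α₂ r₂) 0 ∧
    ¬(deriv (coupling α₁ α₂ r₂) p + deriv (coupling α₁ α₂ r₂) (-p)
        + 4 * deriv (coupling α₁ α₂ r₂) 0 < 0) := by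
  have key : deriv (coupling α₁ α₂ r₂) p + deriv (coupling α₁ α₂ r₂) (-p)
        + 4 * deriv (coupling α₁ α₂ r₂) 0 =
      (Real.cos α₁ / Real.sqrt (r₂ * Real.cos α₂)
        - 2 * Real.sqrt (r₂ * Real.cos α₂)) ^ 2 := by
    have hc : Real.cos α₁ = 2 * (r₂ * Real.cos α₂) * Real.cos p := by
      rw [hp]
      exact (mul_div_cancel₀ _ (mul_pos two_pos hb).ne').symm
    have hs : 0 < Real.sqrt (r₂ * Real.cos α₂) := Real.sqrt_pos.mpr hb
    have hsq : Real.sqrt (r₂ * Real.cos α₂) ^ 2 = r₂ * Real.cos α₂ := Real.sq_sqrt hb.le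
    have hdiv : Real.cos α₁ / Real.sqrt (r₂ * Real.cos α₂)
        = 2 * Real.sqrt (r₂ * Real.cos α₂) * Real.cos p := by
      rw [div_eq_iff hs.ne', hc]
      linear_combination (-2 * Real.cos p) * hsq
    have hR : (2 * Real.sqrt (r₂ * Real.cos α₂) * Real.cos p
        - 2 * Real.sqrt (r₂ * Real.cos α₂)) ^ 2
        = 4 * (r₂ * Real.cos α₂) * (Real.cos p - 1) ^ 2 := by
      linear_combination (4 * (Real.cos p - 1) ^ 2) * hsq
    rw [hdiv, hR, coupling_deriv, coupling_deriv, coupling_deriv]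
    simp only [Real.cos_add, mul_neg, Real.cos_neg, Real.sin_neg, mul_zero, Real.cos_zero,
      Real.sin_zero, Real.cos_two_mul]
    linear_combination (-2 * Real.cos p - 4) * hc
  have hnn := sq_nonneg (Real.cos α₁ / Real.sqrt (r₂ * Real.cos α₂)
        - 2 * Real.sqrt (r₂ * Real.cos α₂))
  rw [← key] at hnn
  exact ⟨key, hnn, not_lt.mpr hnn⟩
end
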